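/- Let ⟨P, A⟩ be an abductive program and ⟨Pⁿ, Aⁿ⟩ its normal form. Then a ground observation G has a (minimal) credulous/skeptical explanation (E, F) with respect to ⟨P, A⟩ if and only if G has a (minimal) credulous/skeptical explanation (n(E), n(F)) with respect to ⟨Pⁿ, Aⁿ⟩, and likewise G has a (minimal) credulous/skeptical anti-explanation (E, F) with respect to ⟨P, A⟩ if and only if G has a (minimal) credulous/skeptical anti-explanation (n(E), n(F)) with respect to ⟨Pⁿ, Aⁿ⟩. -/

import Mathlib

namespace ASP

/-- A ground literal: an atom or its explicit (classical) negation. -/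
inductive Lit (α : Type) where
  | pos : α → Lit α
  | neg : α → Lit α

/-- The complement ¬L of a literal L. -/
def Lit.compl {α : Type} : Lit α → Lit α
  | .pos a => .neg a
  | .neg a => .pos a

/-- The atom of a literal. -/
def Lit.atom {α : Type} : Lit α → α
  | .pos a => a
  | .neg a => a

/-- Map a literal along a function on atoms. -/
def Lit.map {α β : Type} (f : α → β) : Lit α → Lit β
  | .pos a => .pos (f a)
  | .neg a => .neg (f a)

/-- A ground rule  Σ ← Γ, not Δ  with head Σ, positive body Γ, negative body Δ. -/
structure Rule (α : Type) where
  head : Finset (Lit α)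
  pbody : Finset (Lit α)
  nbody : Finset (Lit α)

/-- An extended disjunctive program: a set of ground rules. -/
abbrev Program (α : Type) := Set (Rule α)

/-- Map a rule along a function on atoms. -/
noncomputable def Rule.map {α β : Type} (f : α → β) (r : Rule α) : Rule β :=
  letI := Classical.decEq (Lit β)
  ⟨r.head.image (Lit.map f), r.pbody.image (Lit.map f), r.nbody.image (Lit.map f)⟩

/-- The set of atoms occurring in a rule. -/
def Rule.atoms {α : Type} (r : Rule α) : Set α :=
  Lit.atom '' ((↑r.head : Set (Lit α)) ∪ (↑r.pbody : Set (Lit α)) ∪ (↑r.nbody : Set (Lit α)))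

/-- S satisfies the rule Σ ← Γ, not Δ : if Γ ⊆ S and Δ ∩ S = ∅ then Σ ∩ S ≠ ∅. -/
def Rule.sat {α : Type} (S : Set (Lit α)) (r : Rule α) : Prop :=
  ((↑r.pbody : Set (Lit α)) ⊆ S ∧ ∀ l ∈ r.nbody, l ∉ S) → ∃ l ∈ r.head, l ∈ S

/-- The two closure conditions on candidate answer sets of a not-free program:
S satisfies every rule, and if S contains a complementary pair then S is the
set of all literals of the language. -/
def okNF {α : Type} (P : Program α) (S : Set (Lit α)) : Prop :=
  (∀ r ∈ P, r.sat S) ∧ ((∃ l : Lit α, l ∈ S ∧ l.compl ∈ S) → S = Set.univ)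

/-- Answer set of a not-free program: a minimal set satisfying the conditions. -/
def AnswerSetNF {α : Type} (P : Program α) (S : Set (Lit α)) : Prop :=
  okNF P S ∧ ∀ T, T ⊆ S → okNF P T → T = S

/-- The reduct P^S of a program P with respect to S. -/
def reduct {α : Type} (P : Program α) (S : Set (Lit α)) : Program α :=
  { r' | ∃ r ∈ P, (∀ l ∈ r.nbody, l ∉ S) ∧ r' = ⟨r.head, r.pbody, (∅ : Finset (Lit α))⟩ }

/-- S is an answer set of P if S is an answer set of the reduct P^S. -/
def AnswerSet {α : Type} (P : Program α) (S : Set (Lit α)) : Prop :=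
  AnswerSetNF (reduct P S) S

/-- S is a consistent answer set of P. -/
def ConsAS {α : Type} (P : Program α) (S : Set (Lit α)) : Prop :=
  AnswerSet P S ∧ S ≠ Set.univ

/-- P is consistent: it has a consistent answer set. -/
def Consistent {α : Type} (P : Program α) : Prop := ∃ S, ConsAS P S

/-- P ⊨ G : G belongs to every answer set of P. -/
def Entails {α : Type} (P : Program α) (G : Lit α) : Prop :=
  ∀ S, AnswerSet P S → G ∈ S

/-- The fact L ← . -/
def factOf {α : Type} (l : Lit α) : Rule α := ⟨{l}, ∅, ∅⟩

/-- A set of literals viewed as a program of facts. -/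
def facts {α : Type} (A : Set (Lit α)) : Program α := factOf '' A

/-- The updated program (P \ F) ∪ E. -/
def upd {α : Type} (P E F : Program α) : Program α := (P \ F) ∪ E

/-- Hypothesis condition for (anti-)explanations: E ⊆ A \ P and F ⊆ A ∩ P. -/
def Hyp {α : Type} (P A E F : Program α) : Prop := E ⊆ A \ P ∧ F ⊆ A ∩ P

/-- (E,F) is a credulous explanation of the positive observation G w.r.t. ⟨P,A⟩. -/
def CredExpl {α : Type} (P A : Program α) (G : Lit α) (E F : Program α) : Prop :=
  Hyp P A E F ∧ ∃ S, ConsAS (upd P E F) S ∧ G ∈ S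

/-- (E,F) is a skeptical explanation of the positive observation G w.r.t. ⟨P,A⟩. -/
def SkepExpl {α : Type} (P A : Program α) (G : Lit α) (E F : Program α) : Prop :=
  Hyp P A E F ∧ Consistent (upd P E F) ∧ Entails (upd P E F) G

/-- (E,F) is a credulous anti-explanation of the negative observation G w.r.t. ⟨P,A⟩. -/
def CredAntiExpl {α : Type} (P A : Program α) (G : Lit α) (E F : Program α) : Prop :=
  Hyp P A E F ∧ Consistent (upd P E F) ∧ ¬ Entails (upd P E F) G

/-- (E,F) is a skeptical anti-explanation of the negative observation G w.r.t. ⟨P,A⟩. -/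
def SkepAntiExpl {α : Type} (P A : Program α) (G : Lit α) (E F : Program α) : Prop :=
  Hyp P A E F ∧ Consistent (upd P E F) ∧ ∀ S, AnswerSet (upd P E F) S → G ∉ S

/-- (E,F) is a credulous anti-explanation of the negative observation ⊥ w.r.t. ⟨P,A⟩:
(P \ F) ∪ E is consistent. -/
def CredAntiExplBot {α : Type} (P A : Program α) (E F : Program α) : Prop :=
  Hyp P A E F ∧ Consistent (upd P E F)

/-- (E,F) is a minimal pair among those satisfying X. -/
def MinimalPair {α : Type} (X : Program α → Program α → Prop) (E F : Program α) : Prop :=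
  X E F ∧ ∀ E' F', X E' F' → E' ⊆ E → F' ⊆ F → (E' = E ∧ F' = F)

/-- Standing assumption on abductive programs: any rule of P whose head contains
an abducible has all its head literals abducible and an empty body. -/
def AbdAssum1 {α : Type} (P A : Program α) : Prop :=
  ∀ r ∈ P, (∃ l ∈ r.head, factOf l ∈ A) →
    ((∀ l ∈ r.head, factOf l ∈ A) ∧ r.pbody = ∅ ∧ r.nbody = ∅)

/-- Standing assumption on abductive programs: any (disjunctive) fact of P all of
whose disjuncts are abducibles itself belongs to A. -/
def AbdAssum2 {α : Type} (P A : Program α) : Prop :=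
  ∀ r ∈ P, r.head ≠ ∅ → r.pbody = ∅ → r.nbody = ∅ →
    (∀ l ∈ r.head, factOf l ∈ A) → r ∈ A

/-- Atoms of the update program: base atoms, the fresh atoms ā, +a, −a for abducibles a. -/
inductive UAtom (α : Type) where
  | base : α → UAtom α
  | abar : Lit α → UAtom α
  | aplus : Lit α → UAtom α
  | aminus : Lit α → UAtom α

/-- Embedding of literals over α into literals over UAtom α. -/
def emb {α : Type} : Lit α → Lit (UAtom α) := Lit.map UAtom.base

/-- The update program UP of an abductive program ⟨P, A⟩ with abducible facts A. -/
noncomputable def UP {α : Type} (P : Program α) (A : Set (Lit α)) : Program (UAtom α) :=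
  (Rule.map UAtom.base '' (P \ facts A)) ∪
  { r | ∃ a ∈ A, r = ⟨{emb a}, ∅, {Lit.pos (UAtom.abar a)}⟩ ∨
                 r = ⟨{Lit.pos (UAtom.abar a)}, ∅, {emb a}⟩ } ∪
  { r | ∃ a ∈ A, factOf a ∉ P ∧ r = ⟨{Lit.pos (UAtom.aplus a)}, {emb a}, ∅⟩ } ∪
  { r | ∃ a ∈ A, factOf a ∈ P ∧ r = ⟨{Lit.pos (UAtom.aminus a)}, ∅, {emb a}⟩ }

/-- E⁺ = { +a | a ∈ E }. -/
def pSet {α : Type} (E : Set (Lit α)) : Set (Lit (UAtom α)) :=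
  { l | ∃ a ∈ E, l = Lit.pos (UAtom.aplus a) }

/-- F⁻ = { −a | a ∈ F }. -/
def mSet {α : Type} (F : Set (Lit α)) : Set (Lit (UAtom α)) :=
  { l | ∃ a ∈ F, l = Lit.pos (UAtom.aminus a) }

/-- UA : the set of all update atoms for abducibles A. -/
def UAall {α : Type} (A : Set (Lit α)) : Set (Lit (UAtom α)) := pSet A ∪ mSet A

/-- S is a U-minimal answer set of Q (w.r.t. the update atoms UAs). -/
def UMin {β : Type} (Q : Program β) (UAs : Set (Lit β)) (S : Set (Lit β)) : Prop :=
  AnswerSet Q S ∧ ¬ ∃ T, AnswerSet Q T ∧ T ∩ UAs ⊂ S ∩ UAs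

/-- The constraint ← not G. -/
def notCon {α : Type} (G : Lit α) : Rule α := ⟨∅, ∅, {G}⟩

/-- The constraint ← G. -/
def posCon {α : Type} (G : Lit α) : Rule α := ⟨∅, {G}, ∅⟩

/-- r is a non-disjunctive fact  L ← . -/
def isNDFact {α : Type} (r : Rule α) : Prop :=
  (∃ l, r.head = {l}) ∧ r.pbody = ∅ ∧ r.nbody = ∅

/-- R : the abducibles of A that are not non-disjunctive facts. -/
def Rset {α : Type} (A : Program α) : Program α := { r ∈ A | ¬ isNDFact r }

/-- Σ ← Γ, not Δ, γ_R : the rule R with its name γ_R added to the positive body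
(over the atom type α ⊕ Rule α, the name of R being Sum.inr R). -/
noncomputable def addName {α : Type} (r : Rule α) : Rule (α ⊕ Rule α) :=
  letI := Classical.decEq (Lit (α ⊕ Rule α))
  ⟨(Rule.map Sum.inl r).head,
   insert (Lit.pos (Sum.inr r)) (Rule.map Sum.inl r).pbody,
   (Rule.map Sum.inl r).nbody⟩

/-- Pⁿ of the normal form ⟨Pⁿ, Aⁿ⟩ of an abductive program ⟨P, A⟩. -/
noncomputable def Pn {α : Type} (P A : Program α) : Program (α ⊕ Rule α) :=
  (Rule.map Sum.inl '' (P \ Rset A)) ∪ (addName '' Rset A) ∪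
  (facts { l | ∃ r ∈ Rset A ∩ P, l = Lit.pos (Sum.inr r) })

/-- Aⁿ of the normal form ⟨Pⁿ, Aⁿ⟩, as a set of abducible facts (literals). -/
def An {α : Type} (A : Program α) : Set (Lit (α ⊕ Rule α)) :=
  { l | ∃ r ∈ A, isNDFact r ∧ ∃ l₀, r.head = {l₀} ∧ l = Lit.map Sum.inl l₀ } ∪
  { l | ∃ r ∈ Rset A, l = Lit.pos (Sum.inr r) }

/-- The name n(R) of an abducible rule R: itself (embedded) if R is a
non-disjunctive fact, and the fresh atom γ_R otherwise. -/
noncomputable def nLit {α : Type} (r : Rule α) : Lit (α ⊕ Rule α) :=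
  letI := Classical.dec (isNDFact r)
  if h : isNDFact r then Lit.map Sum.inl h.1.choose else Lit.pos (Sum.inr r)

/-- n(E) = { n(R) | R ∈ E }. -/
noncomputable def nSet {α : Type} (E : Program α) : Set (Lit (α ⊕ Rule α)) := nLit '' E

/-- P' accomplishes a view update for the insertion of G (variable rules V). -/
def ViewInsert {α : Type} (P V : Program α) (G : Lit α) (P' : Program α) : Prop :=
  Consistent P' ∧ Entails P' G ∧ P' \ V = P \ V ∧
  ¬ ∃ P'' : Program α, Consistent P'' ∧ Entails P'' G ∧ P'' \ V = P \ V ∧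
      symmDiff (P ∩ V) (P'' ∩ V) ⊂ symmDiff (P ∩ V) (P' ∩ V)

/-- P' accomplishes a view update for the deletion of G (variable rules V). -/
def ViewDelete {α : Type} (P V : Program α) (G : Lit α) (P' : Program α) : Prop :=
  Consistent P' ∧ ¬ Entails P' G ∧ P' \ V = P \ V ∧
  ¬ ∃ P'' : Program α, Consistent P'' ∧ ¬ Entails P'' G ∧ P'' \ V = P \ V ∧
      symmDiff (P ∩ V) (P'' ∩ V) ⊂ symmDiff (P ∩ V) (P' ∩ V)

/-- P' restores consistency (w.r.t. the integrity constraints, variable rules V). -/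
def Restores {α : Type} (P V : Program α) (P' : Program α) : Prop :=
  Consistent P' ∧ P' \ V = P \ V ∧
  ¬ ∃ P'' : Program α, Consistent P'' ∧ P'' \ V = P \ V ∧
      symmDiff (P ∩ V) (P'' ∩ V) ⊂ symmDiff (P ∩ V) (P' ∩ V)

/-- P' accomplishes a theory update of P by Q. -/
def TheoryUpdate {α : Type} (P Q P' : Program α) : Prop :=
  Consistent P' ∧ Q ⊆ P' ∧ P' ⊆ P ∪ Q ∧
  ¬ ∃ P'' : Program α, Consistent P'' ∧ P' ⊂ P'' ∧ P'' ⊆ P ∪ Q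

/-- P' accomplishes the insertion of the rule R to P. -/
def InsertRule {α : Type} (P : Program α) (R : Rule α) (P' : Program α) : Prop :=
  Consistent P' ∧ R ∈ P' ∧ P' ⊆ P ∪ {R} ∧
  ¬ ∃ P'' : Program α, Consistent P'' ∧ P' ⊂ P'' ∧ P'' ⊆ P ∪ {R}

/-- P' accomplishes the deletion of the rule R from P. -/
def DeleteRule {α : Type} (P : Program α) (R : Rule α) (P' : Program α) : Prop :=
  Consistent P' ∧ P' ⊆ P \ {R} ∧
  ¬ ∃ P'' : Program α, Consistent P'' ∧ P' ⊂ P'' ∧ P'' ⊆ P \ {R}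

/-- P' accomplishes an inconsistency removal of P. -/
def InconsRemoval {α : Type} (P P' : Program α) : Prop :=
  Consistent P' ∧ P' ⊆ P ∧
  ¬ ∃ P'' : Program α, Consistent P'' ∧ P' ⊂ P'' ∧ P'' ⊆ P

theorem Lit.map_injective {α β : Type} {f : α → β} (hf : Function.Injective f) :
    Function.Injective (Lit.map f) := by
  rintro (a | a) (b | b) h <;> simp_all [Lit.map, hf.eq_iff]

theorem Lit.compl_map {α β : Type} (f : α → β) (l : Lit α) :
    (l.map f).compl = l.compl.map f := by
  cases l <;> rfl

theorem Lit.map_inl_ne_pos_inr {α β : Type} (l : Lit α) (b : β) :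
    Lit.map Sum.inl l ≠ Lit.pos (Sum.inr b) := by
  cases l <;> simp [Lit.map]

theorem Rule.mem_head_map {α β : Type} (f : α → β) (r : Rule α) (l : Lit β) :
    l ∈ (r.map f).head ↔ ∃ a ∈ r.head, a.map f = l := by
  simp [Rule.map]

theorem Rule.mem_pbody_map {α β : Type} (f : α → β) (r : Rule α) (l : Lit β) :
    l ∈ (r.map f).pbody ↔ ∃ a ∈ r.pbody, a.map f = l := by
  simp [Rule.map]

theorem Rule.mem_nbody_map {α β : Type} (f : α → β) (r : Rule α) (l : Lit β) :
    l ∈ (r.map f).nbody ↔ ∃ a ∈ r.nbody, a.map f = l := by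
  simp [Rule.map]

theorem Rule.map_injective {α β : Type} {f : α → β} (hf : Function.Injective f) :
    Function.Injective (Rule.map f) := by
  classical
  rintro ⟨h₁, p₁, n₁⟩ ⟨h₂, p₂, n₂⟩ h
  simp only [Rule.map, Rule.mk.injEq] at h
  have key := Finset.image_injective (Lit.map_injective hf)
  obtain ⟨h, p, n⟩ := h
  rw [Rule.mk.injEq]
  exact ⟨key (by convert h), key (by convert p), key (by convert n)⟩

theorem factOf_injective {α : Type} : Function.Injective (factOf (α := α)) := by
  intro a b h
  simpa [factOf] using h

/-- The abducible fact naming a rule in the normal form. -/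
noncomputable def nameFact {α : Type} (r : Rule α) : Rule (α ⊕ Rule α) := factOf (nLit r)

theorem nLit_of_isNDFact {α : Type} {r : Rule α} {l : Lit α} (h : isNDFact r)
    (hl : r.head = {l}) : nLit r = Lit.map Sum.inl l := by
  have h' : l = h.1.choose := Finset.singleton_injective (hl.symm.trans h.1.choose_spec)
  rw [nLit, dif_pos h, ← h']

theorem nLit_of_not_isNDFact {α : Type} {r : Rule α} (h : ¬ isNDFact r) :
    nLit r = Lit.pos (Sum.inr r) := by
  rw [nLit, dif_neg h]

theorem nameFact_of_isNDFact {α : Type} {r : Rule α} (h : isNDFact r) :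
    nameFact r = r.map Sum.inl := by
  obtain ⟨l, hl⟩ := h.1
  rw [nameFact, nLit_of_isNDFact h hl]
  obtain ⟨-, hp, hn⟩ := h
  simp [factOf, Rule.map, hl, hp, hn]

theorem nameFact_of_not_isNDFact {α : Type} {r : Rule α} (h : ¬ isNDFact r) :
    nameFact r = factOf (Lit.pos (Sum.inr r)) := by
  rw [nameFact, nLit_of_not_isNDFact h]

theorem map_inl_ne_factOf_inr {α : Type} (r s : Rule α) :
    r.map Sum.inl ≠ factOf (Lit.pos (Sum.inr s)) := by
  intro h
  have : Lit.pos (Sum.inr s) ∈ (r.map Sum.inl : Rule (α ⊕ Rule α)).head := by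
    rw [h]; simp [factOf]
  obtain ⟨a, -, ha⟩ := (Rule.mem_head_map _ _ _).1 this
  exact Lit.map_inl_ne_pos_inr _ _ ha

theorem addName_ne_nameFact {α : Type} (r s : Rule α) : addName r ≠ nameFact s := by
  intro h
  have := congrArg Rule.pbody h
  simp [addName, nameFact, factOf] at this

theorem nameFact_injective {α : Type} : Function.Injective (nameFact (α := α)) := by
  intro r s h
  by_cases hr : isNDFact r <;> by_cases hs : isNDFact s
  · rw [nameFact_of_isNDFact hr, nameFact_of_isNDFact hs] at h
    exact Rule.map_injective Sum.inl_injective h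
  · rw [nameFact_of_isNDFact hr, nameFact_of_not_isNDFact hs] at h
    exact (map_inl_ne_factOf_inr _ _ h).elim
  · rw [nameFact_of_not_isNDFact hr, nameFact_of_isNDFact hs] at h
    exact (map_inl_ne_factOf_inr _ _ h.symm).elim
  · rw [nameFact_of_not_isNDFact hr, nameFact_of_not_isNDFact hs] at h
    simpa using factOf_injective h

theorem facts_nSet {α : Type} (E : Program α) : facts (nSet E) = nameFact '' E := by
  rw [facts, nSet, Set.image_image]; rfl

theorem An_eq {α : Type} (A : Program α) : An A = nSet A := by
  ext l
  constructor
  · rintro (⟨r, hr, hnd, l₀, hl₀, rfl⟩ | ⟨r, hr, rfl⟩)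
    · exact ⟨r, hr, nLit_of_isNDFact hnd hl₀⟩
    · exact ⟨r, hr.1, nLit_of_not_isNDFact hr.2⟩
  · rintro ⟨r, hr, rfl⟩
    by_cases h : isNDFact r
    · obtain ⟨l₀, hl₀⟩ := h.1
      exact Or.inl ⟨r, hr, h, l₀, hl₀, nLit_of_isNDFact h hl₀⟩
    · exact Or.inr ⟨r, ⟨hr, h⟩, nLit_of_not_isNDFact h⟩

theorem mem_Pn {α : Type} {P A : Program α} {x : Rule (α ⊕ Rule α)} :
    x ∈ Pn P A ↔ (∃ r ∈ P, r ∉ Rset A ∧ r.map Sum.inl = x) ∨ (∃ r ∈ Rset A, addName r = x) ∨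
      ∃ r ∈ P, r ∈ Rset A ∧ nameFact r = x := by
  simp only [Pn, facts, Set.mem_union, Set.mem_image, or_assoc]
  refine or_congr (by simp [and_assoc]) (or_congr Iff.rfl ⟨?_, ?_⟩)
  · rintro ⟨_, ⟨r, hr, rfl⟩, rfl⟩
    exact ⟨r, hr.2, hr.1, nameFact_of_not_isNDFact hr.1.2⟩
  · rintro ⟨r, hP, hR, rfl⟩
    exact ⟨_, ⟨r, ⟨hR, hP⟩, rfl⟩, (nameFact_of_not_isNDFact hR.2).symm⟩

theorem nameFact_mem_Pn {α : Type} {P A : Program α} {r : Rule α} (hr : r ∈ A) :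
    nameFact r ∈ Pn P A ↔ r ∈ P := by
  rw [mem_Pn]
  constructor
  · rintro (⟨s, hs, -, h⟩ | ⟨s, -, h⟩ | ⟨s, hs, -, h⟩)
    · by_cases hnd : isNDFact r
      · rw [nameFact_of_isNDFact hnd] at h
        rwa [← Rule.map_injective Sum.inl_injective h]
      · rw [nameFact_of_not_isNDFact hnd] at h
        exact (map_inl_ne_factOf_inr _ _ h).elim
    · exact (addName_ne_nameFact _ _ h).elim
    · rwa [← nameFact_injective h]
  · intro hP
    by_cases hnd : isNDFact r
    · exact Or.inl ⟨r, hP, fun h => h.2 hnd, (nameFact_of_isNDFact hnd).symm⟩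
    · exact Or.inr (Or.inr ⟨r, hP, ⟨hr, hnd⟩, rfl⟩)

theorem hyp_normalForm_iff {α : Type} (P A E F : Program α) :
    Hyp P A E F ↔ Hyp (Pn P A) (nameFact '' A) (nameFact '' E) (nameFact '' F) := by
  refine and_congr ?_ ?_
  · constructor
    · rintro h _ ⟨r, hr, rfl⟩
      exact ⟨⟨r, (h hr).1, rfl⟩, fun h' => (h hr).2 ((nameFact_mem_Pn (h hr).1).1 h')⟩
    · intro h r hr
      obtain ⟨hA, hP⟩ := h ⟨r, hr, rfl⟩
      have hA := nameFact_injective.mem_set_image.1 hA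
      exact ⟨hA, fun h' => hP ((nameFact_mem_Pn hA).2 h')⟩
  · constructor
    · rintro h _ ⟨r, hr, rfl⟩
      exact ⟨⟨r, (h hr).1, rfl⟩, (nameFact_mem_Pn (h hr).1).2 (h hr).2⟩
    · intro h r hr
      obtain ⟨hA, hP⟩ := h ⟨r, hr, rfl⟩
      have hA := nameFact_injective.mem_set_image.1 hA
      exact ⟨hA, (nameFact_mem_Pn hA).1 hP⟩

/-- Updating commutes with the normal form. -/
theorem upd_Pn {α : Type} {P A E F : Program α} (h : Hyp P A E F) :
    upd (Pn P A) (nameFact '' E) (nameFact '' F) = Pn (upd P E F) A := by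
  ext x
  simp only [upd, Set.mem_union, Set.mem_sdiff]
  constructor
  · rintro (⟨hx, hF⟩ | ⟨r, hr, rfl⟩)
    · rw [mem_Pn] at hx ⊢
      rcases hx with ⟨r, hP, hR, rfl⟩ | hx | ⟨r, hP, hR, rfl⟩
      · refine Or.inl ⟨r, Or.inl ⟨hP, fun hrF => hF ⟨r, hrF, ?_⟩⟩, hR, rfl⟩
        exact nameFact_of_isNDFact (by_contra fun hnd => hR ⟨(h.2 hrF).1, hnd⟩)
      · exact Or.inr (Or.inl hx)
      · exact Or.inr (Or.inr ⟨r, Or.inl ⟨hP, fun hrF => hF ⟨r, hrF, rfl⟩⟩, hR, rfl⟩)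
    · exact (nameFact_mem_Pn (h.1 hr).1).2 (Or.inr hr)
  · rw [mem_Pn]
    rintro (⟨r, hP | hE, hR, rfl⟩ | ⟨r, hR, rfl⟩ | ⟨r, hP | hE, hR, rfl⟩)
    · refine Or.inl ⟨mem_Pn.2 (Or.inl ⟨r, hP.1, hR, rfl⟩), ?_⟩
      rintro ⟨s, hs, hsr⟩
      by_cases hnd : isNDFact s
      · rw [nameFact_of_isNDFact hnd] at hsr
        rw [Rule.map_injective Sum.inl_injective hsr] at hs
        exact hP.2 hs
      · rw [nameFact_of_not_isNDFact hnd] at hsr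
        exact map_inl_ne_factOf_inr _ _ hsr.symm
    · refine Or.inr ⟨r, hE, nameFact_of_isNDFact ?_⟩
      exact by_contra fun hnd => hR ⟨(h.1 hE).1, hnd⟩
    · refine Or.inl ⟨mem_Pn.2 (Or.inr (Or.inl ⟨r, hR, rfl⟩)), ?_⟩
      rintro ⟨s, -, hsr⟩
      exact addName_ne_nameFact _ _ hsr.symm
    · refine Or.inl ⟨mem_Pn.2 (Or.inr (Or.inr ⟨r, hP.1, hR, rfl⟩)), ?_⟩
      exact fun h' => hP.2 (nameFact_injective.mem_set_image.1 h')
    · exact Or.inr ⟨r, hE, rfl⟩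

/-- `T` satisfies every rule of the reduct of `P` with respect to `S`. -/
def Models {α : Type} (P : Program α) (S T : Set (Lit α)) : Prop :=
  ∀ r ∈ P, (∀ l ∈ r.nbody, l ∉ S) → (∀ l ∈ r.pbody, l ∈ T) → ∃ l ∈ r.head, l ∈ T

/-- `S` contains no complementary pair of literals. -/
def PairFree {α : Type} (S : Set (Lit α)) : Prop := ∀ l ∈ S, l.compl ∉ S

theorem okNF_reduct_iff {α : Type} (P : Program α) (S T : Set (Lit α)) :
    okNF (reduct P S) T ↔
      Models P S T ∧ ((∃ l : Lit α, l ∈ T ∧ l.compl ∈ T) → T = Set.univ) := by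
  refine and_congr_left fun _ => ⟨fun h r hr hn hp => ?_, ?_⟩
  · exact h ⟨r.head, r.pbody, ∅⟩ ⟨r, hr, hn, rfl⟩ ⟨hp, by simp⟩
  · rintro h _ ⟨r, hr, hn, rfl⟩ ⟨hp, -⟩
    exact h r hr hn hp

theorem PairFree.ne_univ {α : Type} [Nonempty α] {S : Set (Lit α)} (h : PairFree S) :
    S ≠ Set.univ := by
  rintro rfl
  exact h (Lit.pos (Classical.arbitrary α)) trivial trivial

theorem PairFree.mono {α : Type} {S T : Set (Lit α)} (h : PairFree S) (hT : T ⊆ S) :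
    PairFree T :=
  fun l hl hc => h l (hT hl) (hT hc)

theorem consAS_iff {α : Type} [Nonempty α] (P : Program α) (S : Set (Lit α)) :
    ConsAS P S ↔ PairFree S ∧ Models P S S ∧ ∀ T, T ⊆ S → Models P S T → T = S := by
  simp only [ConsAS, AnswerSet, AnswerSetNF, okNF_reduct_iff]
  constructor
  · rintro ⟨⟨⟨hm, hc⟩, hmin⟩, hne⟩
    have hS : PairFree S := fun l hl hl' => hne (hc ⟨l, hl, hl'⟩)
    refine ⟨hS, hm, fun T hT hTm => hmin T hT ⟨hTm, ?_⟩⟩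
    rintro ⟨l, hl, hl'⟩
    exact (hS.mono hT l hl hl').elim
  · rintro ⟨hS, hm, hmin⟩
    refine ⟨⟨⟨hm, ?_⟩, fun T hT h => hmin T hT h.1⟩, hS.ne_univ⟩
    rintro ⟨l, hl, hl'⟩
    exact (hS l hl hl').elim

/-- A consistent program has only consistent answer sets. -/
theorem Consistent.consAS {α : Type} {P : Program α} (h : Consistent P) {S : Set (Lit α)}
    (hS : AnswerSet P S) : ConsAS P S := by
  refine ⟨hS, ?_⟩
  rintro rfl
  obtain ⟨T, hT, hne⟩ := h
  refine hne (hS.2 T (Set.subset_univ T) ((okNF_reduct_iff _ _ _).2 ?_))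
  have hT := (okNF_reduct_iff _ _ _).1 hT.1
  exact ⟨fun r hr hn => hT.1 r hr fun l hl _ => hn l hl trivial, hT.2⟩

/-- The literals of `S` together with the names of the rules in `N`. -/
def withNames {α : Type} (N : Program α) (S : Set (Lit α)) : Set (Lit (α ⊕ Rule α)) :=
  Lit.map Sum.inl '' S ∪ (fun r => Lit.pos (Sum.inr r)) '' N

theorem map_inl_mem_withNames {α : Type} {N : Program α} {S : Set (Lit α)} {l : Lit α} :
    Lit.map Sum.inl l ∈ withNames N S ↔ l ∈ S := by
  rw [withNames, Set.mem_union, (Lit.map_injective Sum.inl_injective).mem_set_image]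
  refine or_iff_left ?_
  rintro ⟨r, -, hr⟩
  exact Lit.map_inl_ne_pos_inr _ _ hr.symm

theorem pos_inr_mem_withNames {α : Type} {N : Program α} {S : Set (Lit α)} {r : Rule α} :
    Lit.pos (Sum.inr r) ∈ withNames N S ↔ r ∈ N := by
  constructor
  · rintro (⟨l, -, hl⟩ | ⟨s, hs, h⟩)
    · exact (Lit.map_inl_ne_pos_inr _ _ hl).elim
    · simp only [Lit.pos.injEq, Sum.inr.injEq] at h
      rwa [← h]
  · exact fun h => Or.inr ⟨r, h, rfl⟩

theorem preimage_withNames {α : Type} (N : Program α) (S : Set (Lit α)) :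
    Lit.map Sum.inl ⁻¹' withNames N S = S :=
  Set.ext fun _ => map_inl_mem_withNames

theorem PairFree.withNames {α : Type} {S : Set (Lit α)} (h : PairFree S) (N : Program α) :
    PairFree (withNames N S) := by
  rintro _ (⟨l, hl, rfl⟩ | ⟨r, -, rfl⟩) hc
  · rw [Lit.compl_map, map_inl_mem_withNames] at hc
    exact h l hl hc
  · rcases hc with ⟨l, -, hl⟩ | ⟨s, -, hs⟩
    · cases l <;> simp [Lit.map, Lit.compl] at hl
    · simp [Lit.compl] at hs

theorem PairFree.preimage {α : Type} {S' : Set (Lit (α ⊕ Rule α))} (h : PairFree S') :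
    PairFree (Lit.map (Sum.inl : α → α ⊕ Rule α) ⁻¹' S') := by
  intro l hl hc
  refine h _ hl ?_
  rw [Lit.compl_map]
  exact hc

theorem models_Pn_iff {α : Type} (Q A : Program α) (S' T' : Set (Lit (α ⊕ Rule α))) :
    Models (Pn Q A) S' T' ↔
      Models ((Q \ Rset A) ∪ {r ∈ Rset A | Lit.pos (Sum.inr r) ∈ T'})
        (Lit.map Sum.inl ⁻¹' S') (Lit.map Sum.inl ⁻¹' T') ∧
      ∀ r ∈ Q ∩ Rset A, Lit.pos (Sum.inr r) ∈ T' := by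
  constructor
  · refine fun h => ⟨?_, fun r hr => ?_⟩
    · rintro r (⟨hQ, hR⟩ | ⟨hR, hT⟩) hn hp
      · have := h (r.map Sum.inl) (mem_Pn.2 (Or.inl ⟨r, hQ, hR, rfl⟩))
        simpa [Rule.mem_head_map, Rule.mem_pbody_map, Rule.mem_nbody_map] using
          this (by simpa [Rule.mem_nbody_map] using hn) (by simpa [Rule.mem_pbody_map] using hp)
      · have := h (addName r) (mem_Pn.2 (Or.inr (Or.inl ⟨r, hR, rfl⟩)))
        simpa [addName, Rule.mem_head_map] using
          this (by simpa [addName, Rule.mem_nbody_map] using hn)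
            (by simpa [addName, Rule.mem_pbody_map, hT] using hp)
    · have := h (nameFact r) (mem_Pn.2 (Or.inr (Or.inr ⟨r, hr.1, hr.2, rfl⟩)))
      rw [nameFact_of_not_isNDFact hr.2.2] at this
      simpa [factOf] using this
  · rintro ⟨h, hN⟩ x hx hn hp
    rcases mem_Pn.1 hx with ⟨r, hQ, hR, rfl⟩ | ⟨r, hR, rfl⟩ | ⟨r, hQ, hR, rfl⟩
    · have := h r (Or.inl ⟨hQ, hR⟩) (by simpa [Rule.mem_nbody_map] using hn)
        (by simpa [Rule.mem_pbody_map] using hp)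
      simpa [Rule.mem_head_map] using this
    · have hp : Lit.pos (Sum.inr r) ∈ T' ∧ ∀ l ∈ r.pbody, Lit.map Sum.inl l ∈ T' := by
        simpa [addName, Rule.mem_pbody_map] using hp
      have := h r (Or.inr ⟨hR, hp.1⟩) (by simpa [addName, Rule.mem_nbody_map] using hn) hp.2
      simpa [addName, Rule.mem_head_map] using this
    · rw [nameFact_of_not_isNDFact hR.2]
      simpa [factOf] using hN r ⟨hQ, hR⟩

theorem Models.mono {α : Type} {P Q : Program α} {S T : Set (Lit α)} (h : Models Q S T)
    (hPQ : P ⊆ Q) : Models P S T :=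
  fun r hr => h r (hPQ hr)

theorem Models.of_Pn {α : Type} {Q A : Program α} {S' T' : Set (Lit (α ⊕ Rule α))}
    (h : Models (Pn Q A) S' T') :
    Models Q (Lit.map Sum.inl ⁻¹' S') (Lit.map Sum.inl ⁻¹' T') := by
  obtain ⟨h, hN⟩ := (models_Pn_iff _ _ _ _).1 h
  refine h.mono fun r hr => ?_
  by_cases hR : r ∈ Rset A
  · exact Or.inr ⟨hR, hN r ⟨hr, hR⟩⟩
  · exact Or.inl ⟨hr, hR⟩

theorem Models.withNames {α : Type} {Q A : Program α} {S' : Set (Lit (α ⊕ Rule α))}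
    {T : Set (Lit α)} (h : Models Q (Lit.map Sum.inl ⁻¹' S') T) :
    Models (Pn Q A) S' (withNames (Q ∩ Rset A) T) := by
  rw [models_Pn_iff]
  refine ⟨?_, fun r hr => pos_inr_mem_withNames.2 hr⟩
  rw [preimage_withNames]
  refine h.mono ?_
  rintro r (hr | hr)
  · exact hr.1
  · exact (pos_inr_mem_withNames.1 hr.2).1

/-- The consistent answer sets of a normal form are those of the original program, extended
with the names of the abducible rules that are present. -/
theorem consAS_Pn_iff {α : Type} [Nonempty α] (Q A : Program α)
    (S' : Set (Lit (α ⊕ Rule α))) :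
    ConsAS (Pn Q A) S' ↔ ∃ S, ConsAS Q S ∧ withNames (Q ∩ Rset A) S = S' := by
  simp only [consAS_iff]
  constructor
  · rintro ⟨hS, hm, hmin⟩
    have hsub : ∀ T, T ⊆ Lit.map Sum.inl ⁻¹' S' → withNames (Q ∩ Rset A) T ⊆ S' := by
      rintro T hT _ (⟨l, hl, rfl⟩ | ⟨r, hr, rfl⟩)
      · exact hT hl
      · exact ((models_Pn_iff _ _ _ _).1 hm).2 r hr
    refine ⟨Lit.map Sum.inl ⁻¹' S', ⟨hS.preimage, hm.of_Pn, fun T hT hTm => ?_⟩,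
      hmin _ (hsub _ subset_rfl) hm.of_Pn.withNames⟩
    rw [← hmin _ (hsub T hT) hTm.withNames, preimage_withNames]
  · rintro ⟨S, ⟨hS, hm, hmin⟩, rfl⟩
    have hpre := preimage_withNames (Q ∩ Rset A) S
    refine ⟨hS.withNames _, Models.withNames (by rwa [hpre]), fun T' hT' hTm => ?_⟩
    have hT : Lit.map Sum.inl ⁻¹' T' = S := by
      refine hmin _ ?_ ?_
      · rw [← hpre]
        exact Set.preimage_mono hT'
      · have := hTm.of_Pn
        rwa [hpre] at this
    refine hT'.antisymm ?_
    rintro _ (⟨l, hl, rfl⟩ | ⟨r, hr, rfl⟩)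
    · rw [← hT] at hl
      exact hl
    · exact ((models_Pn_iff _ _ _ _).1 hTm).2 r hr

theorem consistent_Pn_iff {α : Type} [Nonempty α] (Q A : Program α) :
    Consistent (Pn Q A) ↔ Consistent Q := by
  simp [Consistent, consAS_Pn_iff]

theorem Consistent.forall_answerSet_iff {α : Type} {P : Program α} (h : Consistent P)
    (p : Set (Lit α) → Prop) : (∀ S, AnswerSet P S → p S) ↔ ∀ S, ConsAS P S → p S :=
  ⟨fun h' S hS => h' S hS.1, fun h' S hS => h' S (h.consAS hS)⟩

theorem forall_answerSet_Pn_iff {α : Type} [Nonempty α] {Q A : Program α}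
    (h : Consistent Q) {p : Set (Lit (α ⊕ Rule α)) → Prop} {q : Set (Lit α) → Prop}
    (hpq : ∀ S, p (withNames (Q ∩ Rset A) S) ↔ q S) :
    (∀ S', AnswerSet (Pn Q A) S' → p S') ↔ ∀ S, AnswerSet Q S → q S := by
  rw [((consistent_Pn_iff Q A).2 h).forall_answerSet_iff, h.forall_answerSet_iff]
  simp [consAS_Pn_iff, hpq]

/-- The correspondence `n` between explanations transfers minimality. -/
theorem minimalPair_image_iff {α β : Type} {φ : Rule α → Rule β} (hφ : Function.Injective φ)
    {X : Program α → Program α → Prop} {Y : Program β → Program β → Prop}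
    (h : ∀ E F, X E F ↔ Y (φ '' E) (φ '' F)) (E F : Program α) :
    MinimalPair X E F ↔ MinimalPair Y (φ '' E) (φ '' F) := by
  refine and_congr (h E F) ⟨fun hm E' F' hY hE hF => ?_, fun hm E' F' hX hE hF => ?_⟩
  · obtain ⟨E', rfl⟩ := Set.subset_range_iff_exists_image_eq.1
      (hE.trans (Set.image_subset_range _ _))
    obtain ⟨F', rfl⟩ := Set.subset_range_iff_exists_image_eq.1
      (hF.trans (Set.image_subset_range _ _))
    obtain ⟨rfl, rfl⟩ := hm E' F' ((h _ _).2 hY) ((Set.image_subset_image_iff hφ).1 hE)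
      ((Set.image_subset_image_iff hφ).1 hF)
    exact ⟨rfl, rfl⟩
  · obtain ⟨h₁, h₂⟩ := hm _ _ ((h _ _).1 hX) (Set.image_mono hE) (Set.image_mono hF)
    exact ⟨hφ.image_injective h₁, hφ.image_injective h₂⟩

section Explanations

variable {α : Type} (P A : Program α) (G : Lit α) (E F : Program α)

theorem credExpl_normalForm_iff : CredExpl P A G E F ↔
    CredExpl (Pn P A) (nameFact '' A) (Lit.map Sum.inl G) (nameFact '' E) (nameFact '' F) := by
  have : Nonempty α := ⟨G.atom⟩
  rw [CredExpl, CredExpl, ← hyp_normalForm_iff]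
  refine and_congr_right fun h => ?_
  simp [upd_Pn h, consAS_Pn_iff, map_inl_mem_withNames]

theorem skepExpl_normalForm_iff : SkepExpl P A G E F ↔
    SkepExpl (Pn P A) (nameFact '' A) (Lit.map Sum.inl G) (nameFact '' E) (nameFact '' F) := by
  have : Nonempty α := ⟨G.atom⟩
  rw [SkepExpl, SkepExpl, ← hyp_normalForm_iff]
  refine and_congr_right fun h => ?_
  rw [upd_Pn h, consistent_Pn_iff]
  exact and_congr_right fun hc =>
    (forall_answerSet_Pn_iff hc fun _ => map_inl_mem_withNames).symm

theorem credAntiExpl_normalForm_iff : CredAntiExpl P A G E F ↔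
    CredAntiExpl (Pn P A) (nameFact '' A) (Lit.map Sum.inl G)
      (nameFact '' E) (nameFact '' F) := by
  have : Nonempty α := ⟨G.atom⟩
  rw [CredAntiExpl, CredAntiExpl, ← hyp_normalForm_iff]
  refine and_congr_right fun h => ?_
  rw [upd_Pn h, consistent_Pn_iff]
  exact and_congr_right fun hc =>
    not_congr (forall_answerSet_Pn_iff hc fun _ => map_inl_mem_withNames).symm

theorem skepAntiExpl_normalForm_iff : SkepAntiExpl P A G E F ↔
    SkepAntiExpl (Pn P A) (nameFact '' A) (Lit.map Sum.inl G)
      (nameFact '' E) (nameFact '' F) := by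
  have : Nonempty α := ⟨G.atom⟩
  rw [SkepAntiExpl, SkepAntiExpl, ← hyp_normalForm_iff]
  refine and_congr_right fun h => ?_
  rw [upd_Pn h, consistent_Pn_iff]
  exact and_congr_right fun hc =>
    (forall_answerSet_Pn_iff hc fun _ => not_congr map_inl_mem_withNames).symm

end Explanations

/-- Proposition 2.1 (normal form transformation): an observation G has a
(minimal) credulous/skeptical (anti-)explanation (E,F) w.r.t. ⟨P,A⟩ iff it has
the (minimal) credulous/skeptical (anti-)explanation (n(E),n(F)) w.r.t. the
normal form ⟨Pⁿ,Aⁿ⟩. -/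
theorem normal_form_transformation {α : Type} (P A : Program α)
    (h1 : AbdAssum1 P A) (h2 : AbdAssum2 P A)
    (G : Lit α) (E F : Program α) :
    (CredExpl P A G E F ↔
      CredExpl (Pn P A) (facts (An A)) (Lit.map Sum.inl G) (facts (nSet E)) (facts (nSet F))) ∧
    (SkepExpl P A G E F ↔
      SkepExpl (Pn P A) (facts (An A)) (Lit.map Sum.inl G) (facts (nSet E)) (facts (nSet F))) ∧
    (CredAntiExpl P A G E F ↔
      CredAntiExpl (Pn P A) (facts (An A)) (Lit.map Sum.inl G) (facts (nSet E)) (facts (nSet F))) ∧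
    (SkepAntiExpl P A G E F ↔
      SkepAntiExpl (Pn P A) (facts (An A)) (Lit.map Sum.inl G) (facts (nSet E)) (facts (nSet F))) ∧
    (MinimalPair (CredExpl P A G) E F ↔
      MinimalPair (CredExpl (Pn P A) (facts (An A)) (Lit.map Sum.inl G)) (facts (nSet E)) (facts (nSet F))) ∧
    (MinimalPair (SkepExpl P A G) E F ↔
      MinimalPair (SkepExpl (Pn P A) (facts (An A)) (Lit.map Sum.inl G)) (facts (nSet E)) (facts (nSet F))) ∧
    (MinimalPair (CredAntiExpl P A G) E F ↔
      MinimalPair (CredAntiExpl (Pn P A) (facts (An A)) (Lit.map Sum.inl G)) (facts (nSet E)) (facts (nSet F))) ∧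
    (MinimalPair (SkepAntiExpl P A G) E F ↔
      MinimalPair (SkepAntiExpl (Pn P A) (facts (An A)) (Lit.map Sum.inl G)) (facts (nSet E)) (facts (nSet F))) := by
  rw [An_eq]
  simp only [facts_nSet]
  have hinj := nameFact_injective (α := α)
  exact ⟨credExpl_normalForm_iff P A G E F, skepExpl_normalForm_iff P A G E F,
    credAntiExpl_normalForm_iff P A G E F, skepAntiExpl_normalForm_iff P A G E F,
    minimalPair_image_iff hinj (credExpl_normalForm_iff P A G) E F,
    minimalPair_image_iff hinj (skepExpl_normalForm_iff P A G) E F,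
    minimalPair_image_iff hinj (credAntiExpl_normalForm_iff P A G) E F,
    minimalPair_image_iff hinj (skepAntiExpl_normalForm_iff P A G) E F⟩

end ASP
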